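/- Let Q be an n×n column-stochastic matrix and d ≥ 1 an integer, and suppose (1/2)||Q − u1†||₁ ≤ 1/(6d²). Then for every column x, the number of indices y with Q(y,x) ≥ (1 − 1/(2d))/n is at least n·(2/3)^{1/d}. -/

import Mathlib

open Matrix Finset

/-- Column-stochastic matrix: nonnegative entries, each column sums to 1. -/
def IsColStochastic {n : ℕ} (Q : Matrix (Fin n) (Fin n) ℝ) : Prop :=
  (∀ y x, 0 ≤ Q y x) ∧ ∀ x, ∑ y, Q y x = 1

/-- The matrix 1-norm: maximum over columns of the sum of absolute values of entries. -/
noncomputable def oneNorm {n : ℕ} (A : Matrix (Fin n) (Fin n) ℝ) : ℝ :=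
  ⨆ x, ∑ y, |A y x|

/-- The all-`1/n` matrix `u1†`. -/
noncomputable def uniMat (n : ℕ) : Matrix (Fin n) (Fin n) ℝ :=
  Matrix.of fun _ _ => 1 / (n : ℝ)

theorem sum_abs_sub_uniMat_le_oneNorm {n : ℕ} (Q : Matrix (Fin n) (Fin n) ℝ) (x : Fin n) :
    ∑ y, |Q y x - 1 / (n : ℝ)| ≤ oneNorm (Q - uniMat n) :=
  le_ciSup (f := fun x => ∑ y, |(Q - uniMat n) y x|) (Set.finite_range _).bddAbove x

theorem two_thirds_rpow_le (d : ℕ) (hd : 1 ≤ d) :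
    (2 / 3 : ℝ) ^ ((1 : ℝ) / d) ≤ 1 - 1 / (3 * (d : ℝ)) := by
  have hd' : (1 : ℝ) ≤ d := by exact_mod_cast hd
  have hsmall : 1 / (3 * (d : ℝ)) ≤ 1 := by
    rw [div_le_one (by positivity)]; linarith
  have bernoulli : (2 / 3 : ℝ) ≤ (1 - 1 / (3 * (d : ℝ))) ^ d := by
    have := one_add_mul_le_pow (a := -(1 / (3 * (d : ℝ)))) (by linarith) d
    calc (2 / 3 : ℝ) = 1 + d * -(1 / (3 * (d : ℝ))) := by field_simp; norm_num
      _ ≤ _ := by simpa [sub_eq_add_neg] using this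
  calc (2 / 3 : ℝ) ^ ((1 : ℝ) / d)
      ≤ ((1 - 1 / (3 * (d : ℝ))) ^ d) ^ ((1 : ℝ) / d) := by gcongr
    _ = 1 - 1 / (3 * (d : ℝ)) := by
      rw [one_div (d : ℝ)]
      exact Real.pow_rpow_inv_natCast (by linarith) (by omega)

/-- Markov-type bound: entries falling short of the mean `1 / n` by more than `c` are few. -/
theorem card_filter_lt_mul_le {n : ℕ} (q : Fin n → ℝ) (hn : 0 < n) (hq : ∑ y, q y = 1) (c : ℝ) :
    ((univ.filter fun y => q y < 1 / (n : ℝ) - c).card : ℝ) * c ≤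
      (1 / 2) * ∑ y, |q y - 1 / (n : ℝ)| := by
  have hsum : ∑ y, (1 / 2) * (|q y - 1 / (n : ℝ)| - (q y - 1 / n)) =
      (1 / 2) * ∑ y, |q y - 1 / (n : ℝ)| := by
    rw [← mul_sum, sum_sub_distrib, sum_sub_distrib, hq]
    have : (n : ℝ) ≠ 0 := by positivity
    simp [this]
  rw [← hsum, ← nsmul_eq_mul, ← sum_const]
  calc _ ≤ ∑ y ∈ univ.filter fun y => q y < 1 / (n : ℝ) - c,
        (1 / 2) * (|q y - 1 / (n : ℝ)| - (q y - 1 / n)) := by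
        refine sum_le_sum fun y hy => ?_
        have := (mem_filter.1 hy).2
        linarith [neg_abs_le (q y - 1 / (n : ℝ))]
    _ ≤ _ := sum_le_sum_of_subset_of_nonneg (filter_subset _ _) fun y _ _ => by
        linarith [le_abs_self (q y - 1 / (n : ℝ))]

/-- If `(1/2)‖Q − u1†‖₁ ≤ 1/(6d²)`, then each column of `Q` has at least `n·(2/3)^{1/d}`
entries bounded below by `(1 − 1/(2d))/n`. -/
theorem column_entries_lb {n : ℕ} (Q : Matrix (Fin n) (Fin n) ℝ)
    (hQ : IsColStochastic Q) (d : ℕ) (hd : 1 ≤ d)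
    (h : (1 / 2) * oneNorm (Q - uniMat n) ≤ 1 / (6 * (d : ℝ) ^ 2)) :
    ∀ x, (n : ℝ) * (2 / 3 : ℝ) ^ ((1 : ℝ) / d) ≤
      ((Finset.univ.filter fun y => (1 - 1 / (2 * (d : ℝ))) / n ≤ Q y x).card : ℝ) := by
  intro x
  have hn : 0 < n := x.pos
  have hn' : (0 : ℝ) < n := by exact_mod_cast hn
  have hd' : (0 : ℝ) < d := by exact_mod_cast hd
  have hthreshold : (1 - 1 / (2 * (d : ℝ))) / n = 1 / (n : ℝ) - 1 / (2 * d * n) := by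
    field_simp
  have hmarkov := card_filter_lt_mul_le (fun y => Q y x) hn (hQ.2 x) (1 / (2 * d * n))
  have hnorm := sum_abs_sub_uniMat_le_oneNorm Q x
  have hcard := card_filter_add_card_filter_not (s := (univ : Finset (Fin n)))
    (fun y => (1 - 1 / (2 * (d : ℝ))) / n ≤ Q y x)
  simp only [not_le, card_univ, Fintype.card_fin] at hcard
  rw [← hthreshold] at hmarkov
  set bad := (univ.filter fun y => Q y x < (1 - 1 / (2 * (d : ℝ))) / n).card
  have hcard' := congrArg (Nat.cast : ℕ → ℝ) hcard
  push_cast at hcard'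
  have hbad : (bad : ℝ) ≤ n * (1 / (3 * d)) := by
    have hle : (bad : ℝ) * (1 / (2 * d * n)) ≤ 1 / (6 * (d : ℝ) ^ 2) := by linarith
    calc (bad : ℝ) = bad * (1 / (2 * d * n)) * (2 * d * n) := by field_simp
      _ ≤ 1 / (6 * (d : ℝ) ^ 2) * (2 * d * n) := by gcongr
      _ = n * (1 / (3 * d)) := by field_simp; norm_num
  have hroot := mul_le_mul_of_nonneg_left (two_thirds_rpow_le d hd) hn'.le
  linarith
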